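/- Let k be a field and F = k((τ)) the field of formal Laurent series over k. Let M be the 2×2 matrix [[0, τ⁻²], [τ⁻¹, 0]] over F. Then a matrix g ∈ SL₂(F) commutes with M (i.e. g·M = M·g) if and only if g has the form [[a, b], [τ·b, a]] for some a, b ∈ F satisfying a² − τ·b² = 1. -/

import Mathlib

/-- A `2 × 2` matrix commutes with `[[0, t⁻²], [t⁻¹, 0]]` iff its diagonal entries agree and its
lower left entry is `t` times its upper right entry. -/
theorem Matrix.mul_antidiag_comm_iff {F : Type*} [Field F] {t : F} (ht : t ≠ 0)
    (A : Matrix (Fin 2) (Fin 2) F) :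
    A * !![0, (t ^ 2)⁻¹; t⁻¹, 0] = !![0, (t ^ 2)⁻¹; t⁻¹, 0] * A ↔
      A 1 1 = A 0 0 ∧ A 1 0 = t * A 0 1 := by
  rw [Matrix.eta_fin_two A]
  simp only [Matrix.mul_fin_two, ← Matrix.ext_iff, Fin.forall_fin_two, Matrix.of_apply,
    Matrix.cons_val', Matrix.cons_val_zero, Matrix.cons_val_one, Matrix.cons_val_fin_one,
    mul_zero, zero_mul, add_zero, zero_add]
  field_simp
  grind

/-- Let `k` be a field and `F = k((τ))` the field of formal Laurent series. Let
`M = [[0, τ⁻²], [τ⁻¹, 0]]`. A matrix `g ∈ SL₂(F)` commutes with `M` iff it has the form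
`[[a, b], [τ·b, a]]` with `a² − τ·b² = 1`. -/
theorem stmt_0 (k : Type*) [Field k]
    (τ : LaurentSeries k) (hτ : τ = HahnSeries.single (1 : ℤ) (1 : k))
    (M : Matrix (Fin 2) (Fin 2) (LaurentSeries k))
    (hM : M = !![0, (τ ^ 2)⁻¹; τ⁻¹, 0])
    (g : Matrix.SpecialLinearGroup (Fin 2) (LaurentSeries k)) :
    (g : Matrix (Fin 2) (Fin 2) (LaurentSeries k)) * M
      = M * (g : Matrix (Fin 2) (Fin 2) (LaurentSeries k)) ↔
    ∃ a b : LaurentSeries k, a ^ 2 - τ * b ^ 2 = 1 ∧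
      (g : Matrix (Fin 2) (Fin 2) (LaurentSeries k)) = !![a, b; τ * b, a] := by
  have ht : τ ≠ 0 := by
    rw [hτ]
    exact HahnSeries.single_ne_zero one_ne_zero
  rw [hM, Matrix.mul_antidiag_comm_iff ht]
  constructor
  · rintro ⟨h₁, h₂⟩
    refine ⟨g 0 0, g 0 1, ?_, ?_⟩
    · have hdet := g.det_coe
      rw [Matrix.det_fin_two, h₁, h₂] at hdet
      linear_combination hdet
    · exact (Matrix.eta_fin_two _).trans (by rw [h₁, h₂])
  · rintro ⟨a, b, -, hg⟩
    simp [hg]
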